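/- (Comparison lemma.) Let ε > 0, let f : ℝ^d → ℝ^d be Borel measurable, and let P be the uniform-ball perturbation kernel associated to f and ε. Let a_1, …, a_n be Borel subsets of ℝ^d, set ă_i = a_i \ ⋃_{j ≠ i} a_j, and assume vol(ă_j) > 0 for every j. Let Q be an n × n real matrix such that for every pair (i, j), either Q_{ij} = 0, or Q_{ij} = vol(ă_j)/vol(B(0,ε)) and a_j ⊆ B(f(x), ε) for every x ∈ a_i. Then for every m ≥ 1, every Borel set A ⊆ ℝ^d, every i, j, and every x ∈ a_i, the m-step transition probability satisfies P^m(x, A ∩ ă_j) ≥ (Q^m)_{ij} · vol(A ∩ ă_j)/vol(ă_j), where Q^m denotes the m-th matrix power. -/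

import Mathlib

open MeasureTheory Metric Set
open scoped ENNReal

/-- The one-step uniform-ball perturbation kernel: from `x`, jump to `f x` and disperse
uniformly on the `ε`-ball around `f x`. -/
noncomputable def ballKernel {d : ℕ} (ε : ℝ)
    (f : EuclideanSpace ℝ (Fin d) → EuclideanSpace ℝ (Fin d))
    (x : EuclideanSpace ℝ (Fin d)) : Measure (EuclideanSpace ℝ (Fin d)) :=
  (volume (ball (0 : EuclideanSpace ℝ (Fin d)) ε))⁻¹ • volume.restrict (ball (f x) ε)

/-- The `m`-step transition probabilities of a kernel `κ`:
`iterP κ 0 x A = 1_A(x)` and `iterP κ (m+1) x A = ∫ iterP κ m y A κ(x, dy)`. -/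
noncomputable def iterP {X : Type*} [MeasurableSpace X] (κ : X → Measure X) :
    ℕ → X → Set X → ℝ≥0∞
  | 0, x, A => A.indicator 1 x
  | m + 1, x, A => ∫⁻ y, iterP κ m y A ∂(κ x)

/-- A function bounded below by constants on finitely many disjoint measurable sets has its
integral bounded below by the corresponding weighted sum; the function need not be measurable. -/
theorem sum_measure_mul_le_lintegral {X ι : Type*} [MeasurableSpace X] [Fintype ι]
    {μ : Measure X} {s : ι → Set X} (hs : ∀ k, MeasurableSet (s k))
    (hd : Pairwise (Function.onFun Disjoint s)) {c : ι → ℝ≥0∞} {g : X → ℝ≥0∞}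
    (hg : ∀ k, ∀ y ∈ s k, c k ≤ g y) :
    ∑ k, μ (s k) * c k ≤ ∫⁻ y, g y ∂μ := by
  calc ∑ k, μ (s k) * c k
      ≤ ∑ k, ∫⁻ y in s k, g y ∂μ := by
        refine Finset.sum_le_sum fun k _ => ?_
        rw [mul_comm, ← setLIntegral_const]
        exact setLIntegral_mono' (hs k) (hg k)
    _ = ∫⁻ y in ⋃ k, s k, g y ∂μ := by
        rw [lintegral_iUnion hs hd, tsum_fintype]
    _ ≤ ∫⁻ y, g y ∂μ := setLIntegral_le_lintegral _ _

theorem iterP_one {X : Type*} [MeasurableSpace X] (κ : X → Measure X) (x : X) {A : Set X}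
    (hA : MeasurableSet A) : iterP κ 1 x A = κ x A := by
  simp only [iterP]
  exact lintegral_indicator_one hA

theorem ofReal_mul_div_le_ballKernel {d : ℕ} {ε : ℝ} (hε : 0 < ε)
    {f : EuclideanSpace ℝ (Fin d) → EuclideanSpace ℝ (Fin d)} {x : EuclideanSpace ℝ (Fin d)}
    {s B : Set (EuclideanSpace ℝ (Fin d))} (hs : 0 < volume s) (hsx : s ⊆ ball (f x) ε)
    (hB : MeasurableSet B) (hBs : B ⊆ s) :
    ENNReal.ofReal ((volume s).toReal /
        (volume (ball (0 : EuclideanSpace ℝ (Fin d)) ε)).toReal) * (volume B / volume s) ≤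
      ballKernel ε f x B := by
  have hb : volume (ball (0 : EuclideanSpace ℝ (Fin d)) ε) ≠ ∞ := measure_ball_lt_top.ne
  have hb0 : volume (ball (0 : EuclideanSpace ℝ (Fin d)) ε) ≠ 0 :=
    (measure_ball_pos volume _ hε).ne'
  have hst : volume s ≠ ∞ := ((measure_mono hsx).trans_lt measure_ball_lt_top).ne
  rw [ENNReal.ofReal_div_of_pos (ENNReal.toReal_pos hb0 hb), ENNReal.ofReal_toReal hb,
    ENNReal.ofReal_toReal hst, ballKernel, Measure.smul_apply, Measure.restrict_apply hB,
    inter_eq_self_of_subset_left (hBs.trans hsx), smul_eq_mul, div_eq_mul_inv, mul_comm (volume s),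
    mul_assoc, ENNReal.mul_div_cancel hs.ne' hst]

theorem ofReal_sum_le_sum_ofReal {ι : Type*} (s : Finset ι) (g : ι → ℝ) :
    ENNReal.ofReal (∑ k ∈ s, g k) ≤ ∑ k ∈ s, ENNReal.ofReal (g k) :=
  Finset.le_sum_of_subadditive ENNReal.ofReal ENNReal.ofReal_zero.le
    (fun _ _ => ENNReal.ofReal_add_le) s g

/-- **Comparison lemma.** If `Q` is a matrix such that each entry is either `0`
or equals `vol(ă_j)/vol(B(0,ε))` with `a_j ⊆ B(f x, ε)` for all `x ∈ a_i`, then the `m`-step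
transition probabilities satisfy `P^m(x, A ∩ ă_j) ≥ (Q^m)_{ij} · vol(A ∩ ă_j)/vol(ă_j)`
for every `x ∈ a_i`. -/
theorem comparison_lemma
    (d : ℕ) (ε : ℝ) (hε : 0 < ε)
    (f : EuclideanSpace ℝ (Fin d) → EuclideanSpace ℝ (Fin d)) (hf : Measurable f)
    (n : ℕ) (a : Fin n → Set (EuclideanSpace ℝ (Fin d)))
    (hameas : ∀ i, MeasurableSet (a i))
    (abreve : Fin n → Set (EuclideanSpace ℝ (Fin d)))
    (habreve : ∀ i, abreve i = a i \ ⋃ j ∈ ({i}ᶜ : Set (Fin n)), a j)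
    (hvol : ∀ j, 0 < volume (abreve j))
    (Q : Matrix (Fin n) (Fin n) ℝ)
    (hQ : ∀ i j, Q i j = 0 ∨
      (Q i j = (volume (abreve j)).toReal /
          (volume (ball (0 : EuclideanSpace ℝ (Fin d)) ε)).toReal ∧
        ∀ x ∈ a i, a j ⊆ ball (f x) ε)) :
    ∀ m : ℕ, 1 ≤ m → ∀ A : Set (EuclideanSpace ℝ (Fin d)), MeasurableSet A →
      ∀ i j : Fin n, ∀ x ∈ a i,
        ENNReal.ofReal ((Q ^ m) i j) * (volume (A ∩ abreve j) / volume (abreve j)) ≤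
          iterP (ballKernel ε f) m x (A ∩ abreve j) := by
  have hsub : ∀ i, abreve i ⊆ a i := fun i => habreve i ▸ sdiff_subset
  have hmeas : ∀ i, MeasurableSet (abreve i) := fun i => by
    rw [habreve]
    exact (hameas i).diff (MeasurableSet.biUnion (to_countable _) fun j _ => hameas j)
  have hdisj : Pairwise (Function.onFun Disjoint abreve) := fun i j hij => by
    refine Set.disjoint_left.2 fun x hxi hxj => ?_
    rw [habreve] at hxi
    exact hxi.2 (mem_biUnion (show j ∈ ({i}ᶜ : Set (Fin n)) from hij.symm) (hsub j hxj))
  have hQnn : ∀ i j, 0 ≤ Q i j := fun i j => by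
    rcases hQ i j with h | ⟨h, -⟩ <;> rw [h]
    positivity
  have hone : ∀ A : Set (EuclideanSpace ℝ (Fin d)), MeasurableSet A → ∀ i j, ∀ x ∈ a i,
      ENNReal.ofReal (Q i j) * (volume (A ∩ abreve j) / volume (abreve j)) ≤
        ballKernel ε f x (A ∩ abreve j) := fun A hA i j x hx => by
    rcases hQ i j with h | ⟨h, hball⟩
    · simp [h]
    · rw [h]
      exact ofReal_mul_div_le_ballKernel hε (hvol j) ((hsub j).trans (hball x hx))
        (hA.inter (hmeas j)) inter_subset_right
  have hentry : ∀ i k, ∀ x ∈ a i, ENNReal.ofReal (Q i k) ≤ ballKernel ε f x (abreve k) :=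
    fun i k x hx => by
      rcases hQ i k with h | ⟨-, hball⟩
      · simp [h]
      · have hfin : volume (abreve k) ≠ ∞ :=
          ((measure_mono ((hsub k).trans (hball x hx))).trans_lt measure_ball_lt_top).ne
        simpa [ENNReal.div_self (hvol k).ne' hfin] using hone univ MeasurableSet.univ i k x hx
  intro m hm A hA
  induction m, hm using Nat.le_induction with
  | base =>
    intro i j x hx
    rw [pow_one, iterP_one _ _ (hA.inter (hmeas j))]
    exact hone A hA i j x hx
  | succ m _ ih =>
    intro i j x hx
    rw [pow_succ', Matrix.mul_apply]
    calc ENNReal.ofReal (∑ k, Q i k * (Q ^ m) k j) * (volume (A ∩ abreve j) / volume (abreve j))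
        ≤ (∑ k, ENNReal.ofReal (Q i k * (Q ^ m) k j)) *
            (volume (A ∩ abreve j) / volume (abreve j)) := by
          gcongr
          exact ofReal_sum_le_sum_ofReal _ _
      _ = ∑ k, ENNReal.ofReal (Q i k) * (ENNReal.ofReal ((Q ^ m) k j) *
            (volume (A ∩ abreve j) / volume (abreve j))) := by
          simp_rw [Finset.sum_mul, ENNReal.ofReal_mul (hQnn i _), mul_assoc]
      _ ≤ ∑ k, ballKernel ε f x (abreve k) * (ENNReal.ofReal ((Q ^ m) k j) *
            (volume (A ∩ abreve j) / volume (abreve j))) := by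
          gcongr with k
          exact hentry i k x hx
      _ ≤ iterP (ballKernel ε f) (m + 1) x (A ∩ abreve j) :=
          sum_measure_mul_le_lintegral hmeas hdisj fun k y hy => ih k j y (hsub k hy)
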